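/- arXiv:2109.00991 — 5 statements merged into one kernel-verified Lean document; each statement's English description precedes it below -/
import Mathlib

section
/- Under hypotheses (1)–(3), there exist unique families of elements t_i ∈ P and q_{t,i} ∈ Q (for t ∈ T, i ∈ ℕ) such that t_0 equals the image of t in R[1/u] and u·t_{i+1} = t_i − q_{t,i} in R[1/u] for all i ≥ 0; moreover, the subring of R[1/u] generated by the image of Q together with all the elements t_i (t ∈ T, i ∈ ℕ) equals P. -/
/-- Context: `h : R → S` a ring homomorphism of commutative rings, `u ∈ R` a
non-zero-divisor with `v = h u` a non-zero-divisor in `S`; `φ : R[1/u] → S[1/v]` the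
induced map of localizations; `P = φ⁻¹(S)` the subring of `R[1/u]` of elements sent by
`φ` into the image of `S`; `h̄ : R → S/(v)` the composite of `h` with the quotient map,
`I = ker h̄`, and `Q ⊆ R` a set of coset representatives for `I` (so `q(t)` denotes the
unique representative of `t + I`).  Assume: (1) `T ∪ Q` generates `R` as a ring;
(2) `{t − q(t) : t ∈ T}` generates `I` as an ideal; (3) `h̄` is surjective.

Statement: there exist unique families `t_i ∈ P` and `q_{t,i} ∈ Q` (for `t ∈ T`,
`i ∈ ℕ`) such that `t_0` is the image of `t` in `R[1/u]` and
`u·t_{i+1} = t_i − q_{t,i}`; moreover, for any such families, the subring of `R[1/u]`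
generated by the image of `Q` together with all the elements `t_i` equals `P`. -/
theorem pullback_subring_generators {R S : Type*} [CommRing R] [CommRing S]
    (h : R →+* S) (u : R) (hu : u ∈ nonZeroDivisors R) (hv : h u ∈ nonZeroDivisors S)
    (φ : Localization.Away u →+* Localization.Away (h u))
    (hφ : ∀ r : R, φ (algebraMap R (Localization.Away u) r)
      = algebraMap S (Localization.Away (h u)) (h r))
    (P : Subring (Localization.Away u))
    (hP : ∀ x : Localization.Away u, x ∈ P ↔
      ∃ s : S, algebraMap S (Localization.Away (h u)) s = φ x)
    (I : Ideal R)
    (hI : I = RingHom.ker ((Ideal.Quotient.mk (Ideal.span {h u})).comp h))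
    (Q : Set R)
    (hQ : ∀ r : R, ∃! q : R, q ∈ Q ∧ r - q ∈ I)
    (T : Set R)
    (h1 : Subring.closure (T ∪ Q) = ⊤)
    (h2 : Ideal.span {x : R | ∃ t ∈ T, ∃ q ∈ Q, t - q ∈ I ∧ x = t - q} = I)
    (h3 : Function.Surjective ((Ideal.Quotient.mk (Ideal.span {h u})).comp h)) :
    (∃! F : T → (ℕ → Localization.Away u) × (ℕ → R),
      (∀ (t : T) (i : ℕ), (F t).1 i ∈ P) ∧
      (∀ (t : T) (i : ℕ), (F t).2 i ∈ Q) ∧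
      (∀ t : T, (F t).1 0 = algebraMap R (Localization.Away u) (t : R)) ∧
      (∀ (t : T) (i : ℕ), algebraMap R (Localization.Away u) u * (F t).1 (i + 1) =
        (F t).1 i - algebraMap R (Localization.Away u) ((F t).2 i))) ∧
    (∀ F : T → (ℕ → Localization.Away u) × (ℕ → R),
      ((∀ (t : T) (i : ℕ), (F t).1 i ∈ P) ∧
       (∀ (t : T) (i : ℕ), (F t).2 i ∈ Q) ∧
       (∀ t : T, (F t).1 0 = algebraMap R (Localization.Away u) (t : R)) ∧
       (∀ (t : T) (i : ℕ), algebraMap R (Localization.Away u) u * (F t).1 (i + 1) =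
         (F t).1 i - algebraMap R (Localization.Away u) ((F t).2 i))) →
      Subring.closure
        ((algebraMap R (Localization.Away u)) '' Q ∪
          {x : Localization.Away u | ∃ (t : T) (i : ℕ), x = (F t).1 i}) = P) := by
  have hu_unit : IsUnit (algebraMap R (Localization.Away u) u) :=
    IsLocalization.Away.algebraMap_isUnit u
  have hv_unit : IsUnit (algebraMap S (Localization.Away (h u)) (h u)) :=
    IsLocalization.Away.algebraMap_isUnit (h u)
  have hinj : Function.Injective (algebraMap S (Localization.Away (h u))) :=
    IsLocalization.injective _ (Submonoid.powers_le.2 hv)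
  have mem_I : ∀ r : R, r ∈ I ↔ ∃ s : S, h r = h u * s := by
    intro r
    rw [hI, RingHom.mem_ker, RingHom.comp_apply, Ideal.Quotient.eq_zero_iff_mem,
      Ideal.mem_span_singleton]
    rfl
  have algebraMap_mem : ∀ r : R, algebraMap R (Localization.Away u) r ∈ P :=
    fun r => (hP _).2 ⟨h r, (hφ r).symm⟩
  -- An element of `R` divisible by `u` in `P` lies in `I`.
  have mem_I_of_eq : ∀ (r : R), ∀ y ∈ P,
      algebraMap R (Localization.Away u) r = algebraMap R (Localization.Away u) u * y →
      r ∈ I := by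
    intro r y hy hry
    obtain ⟨s, hs⟩ := (hP y).1 hy
    refine (mem_I r).2 ⟨s, hinj ?_⟩
    rw [← hφ, hry, map_mul, map_mul, hφ, hs]
  have exists_step : ∀ x ∈ P, ∃ q ∈ Q, ∃ y ∈ P,
      algebraMap R (Localization.Away u) u * y = x - algebraMap R (Localization.Away u) q := by
    intro x hx
    obtain ⟨s, hs⟩ := (hP x).1 hx
    obtain ⟨r, hr⟩ := h3 (Ideal.Quotient.mk _ s)
    obtain ⟨q, ⟨hqQ, hqI⟩, -⟩ := hQ r
    obtain ⟨a, ha⟩ := (mem_I _).1 hqI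
    rw [RingHom.comp_apply, Ideal.Quotient.eq, Ideal.mem_span_singleton] at hr
    obtain ⟨b, hb⟩ := hr
    obtain ⟨y, hy⟩ := hu_unit.dvd (a := x - algebraMap R (Localization.Away u) q)
    refine ⟨q, hqQ, y, (hP y).2 ⟨a - b, hv_unit.mul_left_cancel ?_⟩, hy.symm⟩
    have hφy := congrArg φ hy
    rw [map_mul, map_sub, hφ, hφ, ← hs] at hφy
    rw [← hφy, ← map_mul, ← map_sub]
    congr 1
    rw [map_sub] at ha
    linear_combination hb - ha
  have step_unique : ∀ q ∈ Q, ∀ q' ∈ Q, ∀ y ∈ P, ∀ y' ∈ P,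
      algebraMap R (Localization.Away u) u * y + algebraMap R (Localization.Away u) q =
        algebraMap R (Localization.Away u) u * y' + algebraMap R (Localization.Away u) q' →
      q = q' ∧ y = y' := by
    intro q hq q' hq' y hy y' hy' e
    have hqq : q - q' ∈ I := by
      refine mem_I_of_eq _ (y' - y) (P.sub_mem hy' hy) ?_
      rw [map_sub]
      linear_combination e
    have heq : q = q' := (hQ q).unique ⟨hq, by simp⟩ ⟨hq', hqq⟩
    subst heq
    exact ⟨rfl, hu_unit.mul_left_cancel (add_right_cancel e)⟩
  refine ⟨?_, ?_⟩
  · choose! d hdQ nxt hnxtP hstep using exists_step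
    have iter_mem : ∀ (t : T) (i : ℕ), nxt^[i] (algebraMap R (Localization.Away u) t) ∈ P := by
      intro t i
      induction i with
      | zero => exact algebraMap_mem t
      | succ i ih => rw [Function.iterate_succ_apply']; exact hnxtP _ ih
    refine ⟨fun t => (fun i => nxt^[i] (algebraMap R (Localization.Away u) t),
      fun i => d (nxt^[i] (algebraMap R (Localization.Away u) t))),
      ⟨iter_mem, fun t i => hdQ _ (iter_mem t i), fun t => rfl, fun t i => ?_⟩, ?_⟩
    · simp only [Function.iterate_succ_apply']
      exact hstep _ (iter_mem t i)
    · rintro F ⟨hFP, hFQ, hF0, hFs⟩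
      have key : ∀ (t : T) (i : ℕ), (F t).1 i = nxt^[i] (algebraMap R (Localization.Away u) t) →
          (F t).2 i = d (nxt^[i] (algebraMap R (Localization.Away u) t)) ∧
          (F t).1 (i + 1) = nxt (nxt^[i] (algebraMap R (Localization.Away u) t)) := by
        intro t i e
        refine step_unique _ (hFQ t i) _ (hdQ _ (iter_mem t i)) _ (hFP t (i + 1)) _
          (hnxtP _ (iter_mem t i)) ?_
        linear_combination hFs t i + e - hstep _ (iter_mem t i)
      have hF : ∀ (t : T) (i : ℕ),
          (F t).1 i = nxt^[i] (algebraMap R (Localization.Away u) t) := by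
        intro t i
        induction i with
        | zero => exact hF0 t
        | succ i ih => rw [Function.iterate_succ_apply']; exact (key t i ih).2
      funext t
      exact Prod.ext (funext (hF t)) (funext fun i => (key t i (hF t i)).1)
  · rintro F ⟨hFP, hFQ, hF0, hFs⟩
    set A := Subring.closure ((algebraMap R (Localization.Away u)) '' Q ∪
      {x : Localization.Away u | ∃ (t : T) (i : ℕ), x = (F t).1 i}) with hA
    have hAP : A ≤ P := by
      refine Subring.closure_le.2 ?_
      rintro x (⟨q, -, rfl⟩ | ⟨t, i, rfl⟩)
      · exact algebraMap_mem q
      · exact hFP t i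
    have hFA : ∀ (t : T) (i : ℕ), (F t).1 i ∈ A :=
      fun t i => Subring.subset_closure (Or.inr ⟨t, i, rfl⟩)
    have hRA : ∀ r : R, algebraMap R (Localization.Away u) r ∈ A := by
      have hle : Subring.closure (T ∪ Q) ≤ A.comap (algebraMap R (Localization.Away u)) := by
        refine Subring.closure_le.2 ?_
        rintro x (hx | hx)
        · change algebraMap R (Localization.Away u) x ∈ A
          rw [← hF0 ⟨x, hx⟩]
          exact hFA _ _
        · exact Subring.subset_closure (Or.inl ⟨x, hx, rfl⟩)
      rw [h1] at hle
      exact fun r => hle (Subring.mem_top r)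
    have hIA : ∀ r ∈ I, ∃ b ∈ A, algebraMap R (Localization.Away u) r =
        algebraMap R (Localization.Away u) u * b := by
      intro r hr
      rw [← h2] at hr
      induction hr using Submodule.span_induction with
      | mem x hx =>
        obtain ⟨t, ht, q, hq, htq, rfl⟩ := hx
        have hstep := hFs ⟨t, ht⟩ 0
        rw [hF0] at hstep
        have hI0 : t - (F ⟨t, ht⟩).2 0 ∈ I :=
          mem_I_of_eq _ _ (hFP ⟨t, ht⟩ 1) (by rw [map_sub]; exact hstep.symm)
        have heq : q = (F ⟨t, ht⟩).2 0 := (hQ t).unique ⟨hq, htq⟩ ⟨hFQ _ _, hI0⟩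
        refine ⟨_, hFA ⟨t, ht⟩ 1, ?_⟩
        rw [map_sub, heq]
        exact hstep.symm
      | zero => exact ⟨0, A.zero_mem, by simp⟩
      | add x y _ _ hx hy =>
        obtain ⟨a, ha, hxa⟩ := hx
        obtain ⟨b, hb, hyb⟩ := hy
        exact ⟨a + b, A.add_mem ha hb, by rw [map_add, hxa, hyb, mul_add]⟩
      | smul c x _ hx =>
        obtain ⟨a, ha, hxa⟩ := hx
        exact ⟨algebraMap R (Localization.Away u) c * a, A.mul_mem (hRA c) ha, by
          rw [smul_eq_mul, map_mul, hxa, mul_left_comm]⟩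
    have decomp : ∀ a ∈ A, ∃ r : R, ∃ b ∈ A, a = algebraMap R (Localization.Away u) r +
        algebraMap R (Localization.Away u) u * b := by
      intro a ha
      induction ha using Subring.closure_induction with
      | mem x hx =>
        rcases hx with ⟨q, -, rfl⟩ | ⟨t, i, rfl⟩
        · exact ⟨q, 0, A.zero_mem, by simp⟩
        · exact ⟨(F t).2 i, _, hFA t (i + 1), by rw [hFs]; ring⟩
      | zero => exact ⟨0, 0, A.zero_mem, by simp⟩
      | one => exact ⟨1, 0, A.zero_mem, by simp⟩
      | add x y _ _ hx hy =>
        obtain ⟨r, a, ha, rfl⟩ := hx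
        obtain ⟨s, b, hb, rfl⟩ := hy
        exact ⟨r + s, a + b, A.add_mem ha hb, by rw [map_add]; ring⟩
      | neg x _ hx =>
        obtain ⟨r, a, ha, rfl⟩ := hx
        exact ⟨-r, -a, A.neg_mem ha, by rw [map_neg]; ring⟩
      | mul x y _ hyA hx hy =>
        obtain ⟨r, a, ha, rfl⟩ := hx
        obtain ⟨s, b, hb, rfl⟩ := hy
        refine ⟨r * s, _, A.add_mem (A.mul_mem (hRA r) hb) (A.mul_mem ha hyA), ?_⟩
        rw [map_mul]
        ring
    have descent : ∀ x ∈ P, algebraMap R (Localization.Away u) u * x ∈ A → x ∈ A := by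
      intro x hx hux
      obtain ⟨r, b, hb, e⟩ := decomp _ hux
      have hrI : r ∈ I := by
        refine mem_I_of_eq r (x - b) (P.sub_mem hx (hAP hb)) ?_
        linear_combination -e
      obtain ⟨c, hc, hrc⟩ := hIA r hrI
      have hxcb : x = c + b := by
        refine hu_unit.mul_left_cancel ?_
        rw [e, hrc, mul_add]
      rw [hxcb]
      exact A.add_mem hc hb
    have descent_pow : ∀ (n : ℕ), ∀ x ∈ P,
        algebraMap R (Localization.Away u) u ^ n * x ∈ A → x ∈ A := by
      intro n
      induction n with
      | zero => intro x _ hx; simpa using hx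
      | succ n ih =>
        intro x hx hux
        refine ih x hx (descent _ (P.mul_mem (P.pow_mem (algebraMap_mem u) n) hx) ?_)
        rwa [← mul_assoc, ← pow_succ']
    refine le_antisymm hAP fun x hx => ?_
    obtain ⟨⟨r, ⟨_, n, rfl⟩⟩, hr⟩ := IsLocalization.surj (Submonoid.powers u) x
    refine descent_pow n x hx ?_
    have hr' : algebraMap R (Localization.Away u) u ^ n * x =
        algebraMap R (Localization.Away u) r := by
      rw [← hr, mul_comm]
      simp
    rw [hr']
    exact hRA r
end

section
/- Assume h̄ is surjective. Then for every x ∈ P there exist unique sequences (x_i)_{i∈ℕ} of elements of P and (q_i)_{i∈ℕ} of elements of Q such that x_0 = x and u·x_{i+1} = x_i − q_i in R[1/u] for all i ≥ 0 (where each q_i is regarded in R[1/u] via the canonical map R → R[1/u]). -/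
/-- If every point of `p` has a unique successor in `p` together with a unique label in `B`, then
every point of `p` starts a unique infinite labelled path. -/
theorem existsUnique_path_of_existsUnique_step {X Y : Type*} {p : X → Prop} {B : Y → Prop}
    {A : X → X → Y → Prop}
    (step : ∀ x, p x → ∃! z : X × Y, p z.1 ∧ B z.2 ∧ A x z.1 z.2) (x : X) (hx : p x) :
    ∃! F : (ℕ → X) × (ℕ → Y),
      (∀ i, p (F.1 i)) ∧ (∀ i, B (F.2 i)) ∧ F.1 0 = x ∧ ∀ i, A (F.1 i) (F.1 (i + 1)) (F.2 i) := by
  have : Nonempty (X × Y) := ⟨(step x hx).choose⟩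
  choose! f hf hf' using step
  let a : ℕ → X := fun n => (fun y => (f y).1)^[n] x
  have a_succ (n : ℕ) : a (n + 1) = (f (a n)).1 := Function.iterate_succ_apply' _ _ _
  have ha (n : ℕ) : p (a n) := by
    induction n with
    | zero => exact hx
    | succ n ih => rw [a_succ]; exact (hf _ ih).1
  refine ⟨(a, fun n => (f (a n)).2), ⟨ha, fun n => (hf _ (ha n)).2.1, rfl, fun n => ?_⟩, ?_⟩
  · simpa only [a_succ] using (hf _ (ha n)).2.2
  · rintro ⟨b, c⟩ ⟨hb, hc, hb0, hbc⟩
    dsimp only at hb hc hb0 hbc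
    have key (n : ℕ) : (b (n + 1), c n) = f (b n) :=
      hf' _ (hb n) _ ⟨hb (n + 1), hc n, hbc n⟩
    have hab (n : ℕ) : b n = a n := by
      induction n with
      | zero => exact hb0
      | succ n ih => rw [a_succ, ← ih, ← key n]
    refine Prod.ext (funext hab) (funext fun n => ?_)
    simp only [← hab, ← key]

/-- Division with remainder by `u` in the preimage of `S` under `R[1/u] → S[1/h u]`. -/
theorem existsUnique_quotient_remainder {R S : Type*} [CommRing R] [CommRing S]
    (h : R →+* S) (u : R) (hv : h u ∈ nonZeroDivisors S)
    (φ : Localization.Away u →+* Localization.Away (h u))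
    (hφ : ∀ r : R, φ (algebraMap R (Localization.Away u) r)
      = algebraMap S (Localization.Away (h u)) (h r))
    (Q : Set R)
    (hQ : ∀ r : R, ∃! q : R, q ∈ Q ∧
      r - q ∈ RingHom.ker ((Ideal.Quotient.mk (Ideal.span {h u})).comp h))
    (hsurj : Function.Surjective ((Ideal.Quotient.mk (Ideal.span {h u})).comp h))
    (x : Localization.Away u)
    (hx : ∃ s : S, algebraMap S (Localization.Away (h u)) s = φ x) :
    ∃! z : Localization.Away u × R,
      (∃ s : S, algebraMap S (Localization.Away (h u)) s = φ z.1) ∧ z.2 ∈ Q ∧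
      algebraMap R (Localization.Away u) u * z.1 = x - algebraMap R (Localization.Away u) z.2 := by
  have hinj : Function.Injective (algebraMap S (Localization.Away (h u))) :=
    IsLocalization.injective _ (Submonoid.powers_le.mpr hv)
  have hU : IsUnit (algebraMap R (Localization.Away u) u) :=
    IsLocalization.Away.algebraMap_isUnit u
  have hV : IsUnit (algebraMap S (Localization.Away (h u)) (h u)) :=
    IsLocalization.Away.algebraMap_isUnit (h u)
  obtain ⟨s, hs⟩ := hx
  obtain ⟨r, hr⟩ := hsurj (Ideal.Quotient.mk _ s)
  have mem_iff (q : R) : r - q ∈ RingHom.ker ((Ideal.Quotient.mk (Ideal.span {h u})).comp h) ↔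
      h u ∣ s - h q := by
    rw [RingHom.mem_ker, map_sub, hr, RingHom.comp_apply, ← map_sub, Ideal.Quotient.eq_zero_iff_mem,
      Ideal.mem_span_singleton]
  obtain ⟨q, ⟨hqQ, hq⟩, hq_unique⟩ := hQ r
  obtain ⟨t, ht⟩ := (mem_iff q).mp hq
  obtain ⟨y, hy⟩ := hU.dvd (a := x - algebraMap R (Localization.Away u) q)
  refine ⟨(y, q), ⟨⟨t, hV.mul_left_cancel ?_⟩, hqQ, hy.symm⟩, ?_⟩
  · rw [← map_mul, ← ht, map_sub, hs, ← hφ, ← hφ, ← map_mul, ← hy, map_sub]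
  · rintro ⟨y', q'⟩ ⟨⟨t', ht'⟩, hq'Q, hy'⟩
    dsimp only at ht' hq'Q hy'
    obtain rfl : q' = q := by
      refine hq_unique q' ⟨hq'Q, (mem_iff q').mpr ⟨t', hinj ?_⟩⟩
      rw [map_mul, map_sub, hs, ht', ← hφ, ← hφ, ← map_mul, hy', map_sub]
    rw [hU.mul_left_cancel (hy'.trans hy)]


/-- Context: `h : R → S` a ring homomorphism of commutative rings, `u ∈ R` a
non-zero-divisor with `v = h u` a non-zero-divisor in `S`; `φ : R[1/u] → S[1/v]` the
induced map of localizations; `P = φ⁻¹(S)` the subring of `R[1/u]` of elements sent by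
`φ` into the image of `S`; `h̄ : R → S/(v)` the composite of `h` with the quotient map,
`I = ker h̄`, and `Q ⊆ R` a set of coset representatives for `I`.

Statement: if `h̄` is surjective, then for every `x ∈ P` there exist unique sequences
`(x_i)` in `P` and `(q_i)` in `Q` with `x_0 = x` and `u·x_{i+1} = x_i − q_i` in `R[1/u]`
for all `i`. -/
theorem exists_unique_sequences {R S : Type*} [CommRing R] [CommRing S]
    (h : R →+* S) (u : R) (hu : u ∈ nonZeroDivisors R) (hv : h u ∈ nonZeroDivisors S)
    (φ : Localization.Away u →+* Localization.Away (h u))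
    (hφ : ∀ r : R, φ (algebraMap R (Localization.Away u) r)
      = algebraMap S (Localization.Away (h u)) (h r))
    (P : Subring (Localization.Away u))
    (hP : ∀ x : Localization.Away u, x ∈ P ↔
      ∃ s : S, algebraMap S (Localization.Away (h u)) s = φ x)
    (I : Ideal R)
    (hI : I = RingHom.ker ((Ideal.Quotient.mk (Ideal.span {h u})).comp h))
    (Q : Set R)
    (hQ : ∀ r : R, ∃! q : R, q ∈ Q ∧ r - q ∈ I)
    (hsurj : Function.Surjective ((Ideal.Quotient.mk (Ideal.span {h u})).comp h)) :
    ∀ x ∈ P, ∃! F : (ℕ → Localization.Away u) × (ℕ → R),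
      (∀ i : ℕ, F.1 i ∈ P) ∧ (∀ i : ℕ, F.2 i ∈ Q) ∧
      F.1 0 = x ∧
      ∀ i : ℕ, algebraMap R (Localization.Away u) u * F.1 (i + 1) =
        F.1 i - algebraMap R (Localization.Away u) (F.2 i) := by
  subst hI
  refine existsUnique_path_of_existsUnique_step (p := (· ∈ P)) (B := (· ∈ Q))
    (A := fun x y q => algebraMap R (Localization.Away u) u * y =
      x - algebraMap R (Localization.Away u) q) fun x hx => ?_
  simp only [hP] at hx ⊢
  exact existsUnique_quotient_remainder h u hv φ hφ Q hQ hsurj x hx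
end

section
/- Assume h̄ is surjective. Then for every x ∈ P there exist a unique q ∈ Q and a unique x' ∈ P such that u·x' = x − q in R[1/u] (where q is regarded in R[1/u] via the canonical map R → R[1/u]). -/
/-- Context: `h : R → S` a ring homomorphism of commutative rings, `u ∈ R` a
non-zero-divisor with `v = h u` a non-zero-divisor in `S`; `φ : R[1/u] → S[1/v]` the
induced map of localizations; `P = φ⁻¹(S)` the subring of `R[1/u]` of elements sent by
`φ` into the image of `S`; `h̄ : R → S/(v)` the composite of `h` with the quotient map,
`I = ker h̄`, and `Q ⊆ R` a set of coset representatives for `I`.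

Statement: if `h̄` is surjective, then for every `x ∈ P` there exist a unique `q ∈ Q`
and a unique `x' ∈ P` such that `u·x' = x − q` in `R[1/u]`. -/
theorem exists_unique_step {R S : Type*} [CommRing R] [CommRing S]
    (h : R →+* S) (u : R) (hu : u ∈ nonZeroDivisors R) (hv : h u ∈ nonZeroDivisors S)
    (φ : Localization.Away u →+* Localization.Away (h u))
    (hφ : ∀ r : R, φ (algebraMap R (Localization.Away u) r)
      = algebraMap S (Localization.Away (h u)) (h r))
    (P : Subring (Localization.Away u))
    (hP : ∀ x : Localization.Away u, x ∈ P ↔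
      ∃ s : S, algebraMap S (Localization.Away (h u)) s = φ x)
    (I : Ideal R)
    (hI : I = RingHom.ker ((Ideal.Quotient.mk (Ideal.span {h u})).comp h))
    (Q : Set R)
    (hQ : ∀ r : R, ∃! q : R, q ∈ Q ∧ r - q ∈ I)
    (hsurj : Function.Surjective ((Ideal.Quotient.mk (Ideal.span {h u})).comp h)) :
    ∀ x ∈ P, ∃! qx : R × Localization.Away u,
      qx.1 ∈ Q ∧ qx.2 ∈ P ∧
      algebraMap R (Localization.Away u) u * qx.2 =
        x - algebraMap R (Localization.Away u) qx.1 := by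
  intro x hx
  obtain ⟨s, hs⟩ := (hP x).1 hx
  have hinj : Function.Injective (algebraMap S (Localization.Away (h u))) :=
    IsLocalization.injective _ (Submonoid.powers_le.2 hv)
  have hUu : IsUnit (algebraMap R (Localization.Away u) u) :=
    IsLocalization.Away.algebraMap_isUnit u
  have hUv : IsUnit (algebraMap S (Localization.Away (h u)) (h u)) :=
    IsLocalization.Away.algebraMap_isUnit (h u)
  have mem_I : ∀ a : R, a ∈ I ↔ h u ∣ h a := fun a => by
    rw [hI, RingHom.mem_ker, RingHom.comp_apply, Ideal.Quotient.eq_zero_iff_mem,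
      Ideal.mem_span_singleton]
  obtain ⟨r, hr⟩ := hsurj (Ideal.Quotient.mk _ s)
  rw [RingHom.comp_apply, Ideal.Quotient.eq, Ideal.mem_span_singleton] at hr
  have mem_I_iff : ∀ q : R, r - q ∈ I ↔ h u ∣ s - h q := fun q => by
    rw [mem_I, map_sub, ← dvd_sub_right hr, ← dvd_neg]
    ring_nf
  obtain ⟨q, ⟨hqQ, hqI⟩, hq⟩ := hQ r
  obtain ⟨t, ht⟩ := (mem_I_iff q).1 hqI
  obtain ⟨y, hy⟩ := hUu.dvd (a := x - algebraMap R (Localization.Away u) q)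
  refine ⟨(q, y), ⟨hqQ, (hP y).2 ⟨t, ?_⟩, hy.symm⟩, ?_⟩
  · apply hUv.mul_left_cancel
    rw [← map_mul, ← ht, map_sub, hs, ← hφ, ← hφ, ← map_sub, ← map_mul, hy]
  · rintro ⟨q', y'⟩ ⟨hq'Q, hy'P, hy'⟩
    obtain ⟨t', ht'⟩ := (hP y').1 hy'P
    have hqq : q' = q := by
      refine hq q' ⟨hq'Q, (mem_I_iff q').2 ⟨t', hinj ?_⟩⟩
      rw [map_sub, map_mul, hs, ht', ← hφ, ← hφ, ← map_sub, ← map_mul, hy']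
    subst hqq
    exact Prod.ext rfl (hUu.mul_left_cancel (hy'.trans hy))
end

section
/- Assume h̄ is surjective. Then: (a) J is an ideal of P; (b) the canonical map R → R[1/u] has image contained in P, and the induced ring homomorphism R → P/J is surjective with kernel I, so it induces a ring isomorphism R/I ≅ P/J; (c) the map P → S/(v) sending x ∈ P to the class modulo (v) of the unique s ∈ S whose image in S[1/v] equals φ(x) is a surjective ring homomorphism with kernel J, so it induces a ring isomorphism P/J ≅ S/(v). -/
/-- A ring homomorphism whose range lies in that of an injective one factors through it. -/
theorem RingHom.exists_comp_eq_of_injective {A B C : Type*} [CommRing A] [CommRing B] [CommRing C]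
    (f : B →+* C) (hf : Function.Injective f) (g : A →+* C) (hg : ∀ a, ∃ b, f b = g a) :
    ∃ k : A →+* B, ∀ a, f (k a) = g a := by
  choose k hk using hg
  exact ⟨{ toFun := k
           map_one' := hf (by simp [hk])
           map_mul' := fun a b => hf (by simp [hk])
           map_zero' := hf (by simp [hk])
           map_add' := fun a b => hf (by simp [hk]) }, hk⟩

/-- The first isomorphism theorem for an ideal equal to the kernel. -/
theorem RingHom.exists_quotient_equiv_of_ker_eq {A B : Type*} [CommRing A] [CommRing B]
    (f : A →+* B) (hf : Function.Surjective f) (I : Ideal A) (hI : RingHom.ker f = I) :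
    ∃ e : (A ⧸ I) ≃+* B, ∀ a, e (Ideal.Quotient.mk I a) = f a := by
  subst hI
  exact ⟨RingHom.quotientKerEquivOfSurjective hf, fun _ => rfl⟩

/-- Context: `h : R → S` a ring homomorphism of commutative rings, `u ∈ R` a
non-zero-divisor with `v = h u` a non-zero-divisor in `S`; `φ : R[1/u] → S[1/v]` the
induced map of localizations; `P = φ⁻¹(S)` the subring of `R[1/u]` of elements sent by
`φ` into the image of `S`; `J = {x ∈ P : φ x ∈ v·S}`; `h̄ : R → S/(v)` the composite of
`h` with the quotient map and `I = ker h̄`.  Assume `h̄` is surjective.  Then: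
(a) `J` is an ideal of `P`;
(b) the canonical map `R → R[1/u]` lands in `P`, and the induced homomorphism
`R → P/J` is surjective with kernel `I`, inducing a ring isomorphism `R/I ≅ P/J`;
(c) the map `P → S/(v)` sending `x` to the class of the unique `s ∈ S` with
`φ x = s/1` is a surjective ring homomorphism with kernel `J`, inducing a ring
isomorphism `P/J ≅ S/(v)`. -/
theorem ideal_J_and_isos {R S : Type*} [CommRing R] [CommRing S]
    (h : R →+* S) (u : R) (hu : u ∈ nonZeroDivisors R) (hv : h u ∈ nonZeroDivisors S)
    (φ : Localization.Away u →+* Localization.Away (h u))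
    (hφ : ∀ r : R, φ (algebraMap R (Localization.Away u) r)
      = algebraMap S (Localization.Away (h u)) (h r))
    (P : Subring (Localization.Away u))
    (hP : ∀ x : Localization.Away u, x ∈ P ↔
      ∃ s : S, algebraMap S (Localization.Away (h u)) s = φ x)
    (I : Ideal R)
    (hI : I = RingHom.ker ((Ideal.Quotient.mk (Ideal.span {h u})).comp h))
    (hsurj : Function.Surjective ((Ideal.Quotient.mk (Ideal.span {h u})).comp h)) :
    ∃ J : Ideal P,
      -- (a) `J` is an ideal of `P`, with underlying set `{x ∈ P : φ x ∈ v·S}`: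
      (∀ x : P, x ∈ J ↔ ∃ s : S,
        φ (x : Localization.Away u) = algebraMap S (Localization.Away (h u)) (h u * s)) ∧
      -- (b) the canonical map `R → R[1/u]` lands in `P` ...
      (∀ r : R, algebraMap R (Localization.Away u) r ∈ P) ∧
      (∃ ψ : R →+* P,
        (∀ r : R, (ψ r : Localization.Away u) = algebraMap R (Localization.Away u) r) ∧
        Function.Surjective ((Ideal.Quotient.mk J).comp ψ) ∧
        RingHom.ker ((Ideal.Quotient.mk J).comp ψ) = I ∧
        ∃ e : (R ⧸ I) ≃+* (P ⧸ J),
          ∀ r : R, e (Ideal.Quotient.mk I r) = Ideal.Quotient.mk J (ψ r)) ∧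
      -- (c) the map `P → S/(v)` described above:
      (∃ θ : P →+* S ⧸ Ideal.span {h u},
        (∀ (x : P) (s : S),
          algebraMap S (Localization.Away (h u)) s = φ (x : Localization.Away u) →
          θ x = Ideal.Quotient.mk (Ideal.span {h u}) s) ∧
        Function.Surjective θ ∧
        RingHom.ker θ = J ∧
        ∃ e₂ : (P ⧸ J) ≃+* (S ⧸ Ideal.span {h u}),
          ∀ x : P, e₂ (Ideal.Quotient.mk J x) = θ x) := by
  have hinj : Function.Injective (algebraMap S (Localization.Away (h u))) :=
    IsLocalization.injective _ (Submonoid.powers_le.mpr hv)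
  obtain ⟨σ, hσ⟩ := RingHom.exists_comp_eq_of_injective
    (algebraMap S (Localization.Away (h u))) hinj (φ.comp P.subtype) fun x => (hP x).mp x.2
  have hmem : ∀ r : R, algebraMap R (Localization.Away u) r ∈ P :=
    fun r => (hP _).mpr ⟨h r, (hφ r).symm⟩
  let ψ : R →+* P := (algebraMap R (Localization.Away u)).codRestrict P hmem
  let θ : P →+* S ⧸ Ideal.span {h u} := (Ideal.Quotient.mk (Ideal.span {h u})).comp σ
  have hσ_eq : ∀ (x : P) (s : S),
      algebraMap S (Localization.Away (h u)) s = φ (x : Localization.Away u) → σ x = s :=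
    fun x s hs => hinj ((hσ x).trans hs.symm)
  have hθψ : ∀ r, θ (ψ r) = (Ideal.Quotient.mk (Ideal.span {h u})).comp h r :=
    fun r => congrArg _ (hσ_eq (ψ r) (h r) (hφ r).symm)
  have hθ : Function.Surjective θ := fun y => by
    obtain ⟨r, rfl⟩ := hsurj y
    exact ⟨ψ r, hθψ r⟩
  have hψ : Function.Surjective ((Ideal.Quotient.mk (RingHom.ker θ)).comp ψ) := fun y => by
    obtain ⟨x, rfl⟩ := Ideal.Quotient.mk_surjective y
    obtain ⟨r, hr⟩ := hsurj (θ x)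
    refine ⟨r, Ideal.Quotient.eq.mpr ?_⟩
    rw [RingHom.mem_ker, map_sub, hθψ, hr, sub_self]
  have hker : RingHom.ker ((Ideal.Quotient.mk (RingHom.ker θ)).comp ψ) = I := by
    ext r
    rw [hI, RingHom.mem_ker, RingHom.mem_ker, RingHom.comp_apply, Ideal.Quotient.eq_zero_iff_mem,
      RingHom.mem_ker, hθψ]
  refine ⟨RingHom.ker θ, fun x => ?_, hmem,
    ⟨ψ, fun _ => rfl, hψ, hker, RingHom.exists_quotient_equiv_of_ker_eq _ hψ I hker⟩,
    θ, fun x s hs => congrArg _ (hσ_eq x s hs), hθ, rfl,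
    RingHom.exists_quotient_equiv_of_ker_eq θ hθ _ rfl⟩
  rw [RingHom.mem_ker, RingHom.comp_apply, Ideal.Quotient.eq_zero_iff_mem,
    Ideal.mem_span_singleton]
  exact ⟨fun ⟨s, hs⟩ => ⟨s, hs ▸ (hσ x).symm⟩, fun ⟨s, hs⟩ => ⟨s, hσ_eq x _ hs.symm⟩⟩
end

section
/- The fixed subring A^ρ = {a ∈ A : ρ(a) = a} equals the B-submodule of A generated by 1 together with the elements x_I + y_I for all subsets I ⊆ {1,…,n}. -/
open MvPolynomial

namespace MvPolynomial

variable {R : Type*} [CommRing R]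

/-- A polynomial fixed by an involution `f` of the variables is the sum of a polynomial, its image
under `f`, and a polynomial supported on monomials fixed by `f`. -/
theorem exists_add_rename_add_of_rename_eq {σ : Type*} {f : σ → σ} (hf : Function.Involutive f)
    {a : MvPolynomial σ R} (ha : rename f a = a) :
    ∃ p d : MvPolynomial σ R, a = p + rename f p + d ∧
      ∀ m ∈ d.support, Finsupp.mapDomain f m = m := by
  classical
  let g : (σ →₀ ℕ) → (σ →₀ ℕ) := Finsupp.mapDomain f
  have hg : Function.Involutive g := fun m => by
    simp only [g, ← Finsupp.mapDomain_comp, hf.comp_self, Finsupp.mapDomain_id]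
  have hcoeff (p : MvPolynomial σ R) (m : σ →₀ ℕ) : coeff m (rename f p) = coeff (g m) p := by
    conv_lhs => rw [← hg m]
    exact coeff_rename_mapDomain f hf.injective p (g m)
  let r : (σ →₀ ℕ) → (σ →₀ ℕ) → Prop := WellOrderingRel
  let part (q : (σ →₀ ℕ) → Prop) : MvPolynomial σ R :=
    ∑ m ∈ a.support with q m, monomial m (coeff m a)
  have hpart (q : (σ →₀ ℕ) → Prop) (m : σ →₀ ℕ) :
      coeff m (part q) = if q m then coeff m a else 0 := by
    simp only [part, coeff_sum, coeff_monomial, Finset.sum_ite_eq', Finset.mem_filter,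
      mem_support_iff]
    grind
  refine ⟨part fun m => r m (g m), part fun m => g m = m, ?_, fun m hm => ?_⟩
  · ext m
    have hm : coeff (g m) a = coeff m a := by rw [← hcoeff, ha]
    rw [coeff_add, coeff_add, hcoeff, hpart, hpart, hpart, hg m, hm]
    rcases trichotomous_of r m (g m) with h | h | h
    · have h' : ¬ r (g m) m := asymm_of r h
      have hne : g m ≠ m := fun e => irrefl_of r m (by rwa [e] at h)
      simp [h, h', hne]
    · have hi : ¬ r m m := irrefl_of r m
      simp [← h, hi]
    · have h' : ¬ r m (g m) := asymm_of r h
      have hne : g m ≠ m := fun e => irrefl_of r m (by rwa [e] at h)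
      simp [h, h', hne]
  · rw [mem_support_iff, hpart] at hm
    by_contra h
    exact hm (if_neg h)

variable {ι : Type*} {B : Subalgebra R (MvPolynomial (ι ⊕ ι) R)}

/-- A monomial fixed by `Sum.swap` is a polynomial in the products `x_i * y_i`. -/
theorem monomial_mem_of_mapDomain_swap_eq [Fintype ι]
    (hmul : ∀ i, X (Sum.inl i) * X (Sum.inr i) ∈ B)
    {m : ι ⊕ ι →₀ ℕ} (hm : Finsupp.mapDomain Sum.swap m = m) (c : R) :
    monomial m c ∈ B := by
  have h (i : ι) : m (Sum.inr i) = m (Sum.inl i) := by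
    conv_lhs => rw [← hm]
    exact Finsupp.mapDomain_apply Sum.swap_leftInverse.injective m (Sum.inl i)
  rw [monomial_eq, Finsupp.prod_fintype _ _ fun _ => pow_zero _, Fintype.prod_sum_type,
    ← Finset.prod_mul_distrib]
  refine B.mul_mem (B.algebraMap_mem c) (B.prod_mem fun i _ => ?_)
  rw [h, ← mul_pow]
  exact B.pow_mem (hmul i) _

/-- The squarefree monomials in the `x_i` span the polynomial ring over any subalgebra containing
all `x_i + y_i` and `x_i * y_i`. -/
theorem span_range_prod_X_inl_eq_top
    (hadd : ∀ i, X (Sum.inl i) + X (Sum.inr i) ∈ B)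
    (hmul : ∀ i, X (Sum.inl i) * X (Sum.inr i) ∈ B) :
    Submodule.span B (Set.range fun I : Finset ι =>
      (∏ i ∈ I, X (Sum.inl i) : MvPolynomial (ι ⊕ ι) R)) = ⊤ := by
  classical
  set S := Submodule.span B (Set.range fun I : Finset ι =>
      (∏ i ∈ I, X (Sum.inl i) : MvPolynomial (ι ⊕ ι) R))
  have hprod (I : Finset ι) : (∏ i ∈ I, X (Sum.inl i) : MvPolynomial (ι ⊕ ι) R) ∈ S :=
    Submodule.subset_span ⟨I, rfl⟩
  have hsmul {b p : MvPolynomial (ι ⊕ ι) R} (hb : b ∈ B) (hp : p ∈ S) : b * p ∈ S :=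
    S.smul_mem ⟨b, hb⟩ hp
  have hinl (i : ι) {p : MvPolynomial (ι ⊕ ι) R} (hp : p ∈ S) : X (Sum.inl i) * p ∈ S := by
    induction hp using Submodule.span_induction with
    | mem p hp =>
      obtain ⟨I, rfl⟩ := hp
      dsimp only
      by_cases hi : i ∈ I
      · have key : X (Sum.inl i) * ∏ j ∈ I, X (Sum.inl j) =
            (X (Sum.inl i) + X (Sum.inr i)) * ∏ j ∈ I, X (Sum.inl j) -
              X (Sum.inl i) * X (Sum.inr i) *
                (∏ j ∈ I.erase i, X (Sum.inl j) : MvPolynomial (ι ⊕ ι) R) := by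
          rw [← Finset.mul_prod_erase I _ hi]
          ring
        rw [key]
        exact S.sub_mem (hsmul (hadd i) (hprod I)) (hsmul (hmul i) (hprod _))
      · rw [← Finset.prod_insert (f := fun j => X (Sum.inl j)) hi]
        exact hprod _
    | zero => rw [mul_zero]; exact S.zero_mem
    | add p q _ _ hp hq => rw [mul_add]; exact S.add_mem hp hq
    | smul b p _ hp => rw [mul_smul_comm]; exact S.smul_mem b hp
  refine (Submodule.eq_top_iff').2 fun p => ?_
  induction p using MvPolynomial.induction_on with
  | C c =>
    have h := hsmul (B.algebraMap_mem c) (hprod ∅)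
    rwa [Finset.prod_empty, mul_one] at h
  | add p q hp hq => exact S.add_mem hp hq
  | mul_X p s hp =>
    rw [mul_comm]
    rcases s with i | i
    · exact hinl i hp
    · have key : X (Sum.inr i) * p =
          (X (Sum.inl i) + X (Sum.inr i)) * p - X (Sum.inl i) * p := by ring
      rw [key]
      exact S.sub_mem (hsmul (hadd i) hp) (hinl i hp)

end MvPolynomial

/-- Let `A = ℤ[x₁,y₁,…,xₙ,yₙ]` (realized as `MvPolynomial (Fin n ⊕ Fin n) ℤ`, with
`x_i = X (Sum.inl i)`, `y_i = X (Sum.inr i)`), let `B` be the `ℤ`-subalgebra generated by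
the elements `x_i + y_i` and `x_i·y_i`, and let `ρ` be the ring involution of `A`
interchanging each `x_i` with `y_i` (i.e. `rename Sum.swap`).  Then the fixed subring
`A^ρ` equals the `B`-submodule of `A` generated by `1` together with the elements
`x_I + y_I` for all subsets `I ⊆ {1,…,n}`. -/
theorem fixed_subring_eq_span (n : ℕ)
    (B : Subalgebra ℤ (MvPolynomial (Fin n ⊕ Fin n) ℤ))
    (hB : B = Algebra.adjoin ℤ
      ({p | ∃ i : Fin n, p = X (Sum.inl i) + X (Sum.inr i)} ∪
       {p | ∃ i : Fin n, p = X (Sum.inl i) * X (Sum.inr i)})) :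
    ∀ a : MvPolynomial (Fin n ⊕ Fin n) ℤ,
      rename (Sum.swap : Fin n ⊕ Fin n → Fin n ⊕ Fin n) a = a ↔
      a ∈ Submodule.span B
        (insert (1 : MvPolynomial (Fin n ⊕ Fin n) ℤ)
          {p | ∃ I : Finset (Fin n),
            p = (∏ i ∈ I, X (Sum.inl i)) + ∏ i ∈ I, X (Sum.inr i)}) := by
  subst hB
  set B := Algebra.adjoin ℤ
      ({p : MvPolynomial (Fin n ⊕ Fin n) ℤ | ∃ i : Fin n, p = X (Sum.inl i) + X (Sum.inr i)} ∪
       {p | ∃ i : Fin n, p = X (Sum.inl i) * X (Sum.inr i)})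
  have hadd (i : Fin n) : X (Sum.inl i) + X (Sum.inr i) ∈ B :=
    Algebra.subset_adjoin (Or.inl ⟨i, rfl⟩)
  have hmul (i : Fin n) : X (Sum.inl i) * X (Sum.inr i) ∈ B :=
    Algebra.subset_adjoin (Or.inr ⟨i, rfl⟩)
  have hfix {b : MvPolynomial (Fin n ⊕ Fin n) ℤ} (hb : b ∈ B) : rename Sum.swap b = b := by
    have hle : B ≤ AlgHom.equalizer (rename Sum.swap) (AlgHom.id ℤ _) := by
      refine Algebra.adjoin_le ?_
      rintro _ (⟨i, rfl⟩ | ⟨i, rfl⟩)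
      · simp [add_comm]
      · simp [mul_comm]
    exact hle hb
  intro a
  set T := Submodule.span B
        (insert (1 : MvPolynomial (Fin n ⊕ Fin n) ℤ)
          {p | ∃ I : Finset (Fin n),
            p = (∏ i ∈ I, X (Sum.inl i)) + ∏ i ∈ I, X (Sum.inr i)})
  constructor
  · intro ha
    have hBT {b : MvPolynomial (Fin n ⊕ Fin n) ℤ} (hb : b ∈ B) : b ∈ T := by
      have h := T.smul_mem (⟨b, hb⟩ : B) (Submodule.subset_span (Set.mem_insert _ _))
      rwa [Subalgebra.smul_def, smul_eq_mul, mul_one] at h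
    have htrace (p : MvPolynomial (Fin n ⊕ Fin n) ℤ) : p + rename Sum.swap p ∈ T := by
      have hp : p ∈ Submodule.span B (Set.range fun I : Finset (Fin n) =>
          (∏ i ∈ I, X (Sum.inl i) : MvPolynomial (Fin n ⊕ Fin n) ℤ)) := by
        rw [span_range_prod_X_inl_eq_top hadd hmul]
        exact Submodule.mem_top
      induction hp using Submodule.span_induction with
      | mem p hp =>
        obtain ⟨I, rfl⟩ := hp
        exact Submodule.subset_span (Or.inr ⟨I, by simp [map_prod]⟩)
      | zero => simp
      | add p q _ _ hp hq =>
        rw [map_add, add_add_add_comm]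
        exact T.add_mem hp hq
      | smul b p _ hp =>
        rw [Subalgebra.smul_def, smul_eq_mul, map_mul, hfix b.2, ← mul_add]
        exact T.smul_mem b hp
    obtain ⟨p, d, rfl, hd⟩ :=
      exists_add_rename_add_of_rename_eq (f := Sum.swap) Sum.swap_swap ha
    refine T.add_mem (htrace p) (hBT ?_)
    rw [d.as_sum]
    exact B.sum_mem fun m hm => monomial_mem_of_mapDomain_swap_eq hmul (hd m hm) _
  · intro ha
    induction ha using Submodule.span_induction with
    | mem p hp =>
      rcases hp with rfl | ⟨I, rfl⟩
      · exact map_one _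
      · simp [map_prod, add_comm]
    | zero => exact map_zero _
    | add p q _ _ hp hq => rw [map_add, hp, hq]
    | smul b p _ hp => rw [Subalgebra.smul_def, smul_eq_mul, map_mul, hfix b.2, hp]
end
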